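/- Suppose that every sequence (f_n) of non-discontinuous functions from Cantor space 2^ℕ to ℝ that converges semi-uniformly at every point to a non-discontinuous function f : 2^ℕ → ℝ in fact converges to f uniformly. Then UCT holds: every pointwise continuous function from 2^ℕ to ℝ is uniformly continuous. -/

import Mathlib

open Filter

/-- The metric on Cantor space `ℕ → Bool`, with `dist α β = 2 ^ (-k)` where `k`
is the first index at which `α` and `β` differ. -/
noncomputable local instance : MetricSpace (ℕ → Bool) := PiNat.metricSpace

/-- A function between metric spaces is non-discontinuous. -/
def NonDiscontinuous {X Y : Type*} [MetricSpace X] [MetricSpace Y] (h : X → Y) : Prop :=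
  ¬ ∃ (x : X) (u : ℕ → X) (ε : ℝ), 0 < ε ∧ Tendsto u atTop (nhds x) ∧
      ∀ n : ℕ, dist (h (u n)) (h x) ≥ ε

/-- `f n → g` semi-uniformly at `x`. -/
def SemiUniformAt {X Y : Type*} [MetricSpace X] [MetricSpace Y]
    (f : ℕ → X → Y) (g : X → Y) (x : X) : Prop :=
  ∀ ε : ℝ, 0 < ε → ∃ N : ℕ, ∃ δ : ℝ, 0 < δ ∧
    ∀ y : X, dist x y < δ → ∀ i ≥ N, dist (g y) (f i y) < ε

/-- The sequence that agrees with `α` below `n` and is constantly `false` from there on. -/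
def truncateAt (n : ℕ) (α : ℕ → Bool) : ℕ → Bool := fun k => if k < n then α k else false

theorem dist_le_half_pow_iff {α β : ℕ → Bool} {n : ℕ} :
    dist α β ≤ (1 / 2 : ℝ) ^ n ↔ ∀ k < n, α k = β k :=
  PiNat.mem_cylinder_iff_dist_le.symm

theorem truncateAt_eq_of_dist_le {α β : ℕ → Bool} {n : ℕ} (h : dist α β ≤ (1 / 2 : ℝ) ^ n) :
    truncateAt n α = truncateAt n β := by
  funext k
  by_cases hk : k < n
  · simp [truncateAt, hk, dist_le_half_pow_iff.1 h k hk]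
  · simp [truncateAt, hk]

theorem NonDiscontinuous.of_continuousAt {X Y : Type*} [MetricSpace X] [MetricSpace Y] {h : X → Y}
    (hc : ∀ x, ContinuousAt h x) : NonDiscontinuous h := by
  rintro ⟨x, u, ε, hε, hu, hfar⟩
  obtain ⟨n, hn⟩ := (Metric.tendsto_nhds.1 ((hc x).tendsto.comp hu) ε hε).exists
  exact (hfar n).not_gt hn

theorem nonDiscontinuous_comp_truncateAt (g : (ℕ → Bool) → ℝ) (n : ℕ) :
    NonDiscontinuous fun α => g (truncateAt n α) :=
  .of_continuousAt fun x => Metric.continuousAt_iff.2 fun ε hε =>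
    ⟨(1 / 2 : ℝ) ^ n, by positivity, fun y hy => by
      simpa [truncateAt_eq_of_dist_le hy.le] using hε⟩

theorem semiUniformAt_comp_truncateAt {g : (ℕ → Bool) → ℝ} {x : ℕ → Bool}
    (hg : ContinuousAt g x) : SemiUniformAt (fun n α => g (truncateAt n α)) g x := by
  intro ε hε
  obtain ⟨δ, hδ, hgδ⟩ := Metric.continuousAt_iff.1 hg (ε / 2) (half_pos hε)
  obtain ⟨N, hN⟩ := exists_pow_lt_of_lt_one hδ (by norm_num : (1 / 2 : ℝ) < 1)
  refine ⟨N, (1 / 2 : ℝ) ^ N, by positivity, fun y hy i hi => ?_⟩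
  rw [dist_comm] at hy
  have hyi : dist (truncateAt i y) x ≤ (1 / 2 : ℝ) ^ N :=
    dist_le_half_pow_iff.2 fun k hk => by
      simpa [truncateAt, hk.trans_le hi] using dist_le_half_pow_iff.1 hy.le k hk
  have h₁ := hgδ (hy.trans hN)
  have h₂ := hgδ (hyi.trans_lt hN)
  linarith [dist_triangle_right (g y) (g (truncateAt i y)) (g x)]

/-- If every semi-uniformly convergent sequence of non-discontinuous functions
on Cantor space converges uniformly, then the uniform continuity theorem holds. -/
theorem uct_of_semiUniform_to_uniform
    (H : ∀ (f : ℕ → (ℕ → Bool) → ℝ) (g : (ℕ → Bool) → ℝ),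
      (∀ n, NonDiscontinuous (f n)) → NonDiscontinuous g →
      (∀ x : ℕ → Bool, SemiUniformAt f g x) →
      ∀ ε : ℝ, 0 < ε → ∃ N : ℕ, ∀ n ≥ N, ∀ α : ℕ → Bool, dist (f n α) (g α) < ε) :
    ∀ g : (ℕ → Bool) → ℝ, (∀ x : ℕ → Bool, ContinuousAt g x) →
      ∀ ε : ℝ, 0 < ε → ∃ δ : ℝ, 0 < δ ∧
        ∀ α β : ℕ → Bool, dist α β < δ → dist (g α) (g β) < ε := by
  intro g hg ε hε
  obtain ⟨N, hN⟩ := H (fun n α => g (truncateAt n α)) g (nonDiscontinuous_comp_truncateAt g)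
    (.of_continuousAt hg) (fun x => semiUniformAt_comp_truncateAt (hg x)) (ε / 2) (half_pos hε)
  refine ⟨(1 / 2 : ℝ) ^ N, by positivity, fun α β hαβ => ?_⟩
  have hα := hN N le_rfl α
  have hβ := hN N le_rfl β
  rw [truncateAt_eq_of_dist_le hαβ.le] at hα
  linarith [dist_triangle_left (g α) (g β) (g (truncateAt N β))]
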